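/- Let C be a semi-dualizing (R,S)-bimodule and X a C-reflexive left R-module. Then there exists a short exact sequence 0 → X → C⁰ → X¹ → 0 with C⁰ a finite direct sum of copies of C and X¹ a C-reflexive R-module. -/

import Mathlib

open CategoryTheory

/-- The `i`-th Ext group of finitely generated modules, as a module over `ℤ`. -/
noncomputable abbrev ExtGrp (A : Type) [Ring A] (i : ℕ) (M N : Type) [AddCommGroup M] [Module A M]
    [AddCommGroup N] [Module A N] : Type :=
  ((Ext ℤ (ModuleCat.{0} A) i).obj (Opposite.op (ModuleCat.of A M))).obj (ModuleCat.of A N)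

section Bimodule

variable (R S : Type) [Ring R] [Ring S]
variable (C : Type) [AddCommGroup C] [Module R C] [Module Sᵐᵒᵖ C]
  [SMulCommClass R Sᵐᵒᵖ C] [SMulCommClass Sᵐᵒᵖ R C]

/-- right homothety `S → Hom_R(C,C)`. -/
def rightHomothety (s : S) : C →ₗ[R] C where
  toFun c := MulOpposite.op s • c
  map_add' := smul_add _
  map_smul' r c := smul_comm _ r c

/-- left homothety `R → Hom_S(C,C)`. -/
def leftHomothety (r : R) : C →ₗ[Sᵐᵒᵖ] C where
  toFun c := r • c
  map_add' := smul_add _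
  map_smul' s c := smul_comm _ s c

/-- `C` is a semi-dualizing `(R,S)`-bimodule. -/
structure IsSemidualizing : Prop where
  bij_right : Function.Bijective (rightHomothety R S C)
  bij_left : Function.Bijective (leftHomothety R S C)
  ext_right : ∀ i : ℕ, 0 < i → Subsingleton (ExtGrp R i C C)
  ext_left : ∀ i : ℕ, 0 < i → Subsingleton (ExtGrp Sᵐᵒᵖ i C C)

variable (M : Type) [AddCommGroup M] [Module R M]

/-- the biduality (evaluation) map `M → Hom_S(Hom_R(M,C),C)`. -/
def bidualityMap (m : M) : (M →ₗ[R] C) →ₗ[Sᵐᵒᵖ] C where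
  toFun f := f m
  map_add' _ _ := rfl
  map_smul' _ _ := rfl

/-- a finitely generated left `R`-module `M` is `C`-reflexive. -/
structure IsCReflexive : Prop where
  ext_vanish : ∀ i : ℕ, 0 < i → Subsingleton (ExtGrp R i M C)
  ext_dual_vanish : ∀ i : ℕ, 0 < i → Subsingleton (ExtGrp Sᵐᵒᵖ i (M →ₗ[R] C) C)
  bij : Function.Bijective (bidualityMap R S C M)

variable (N : Type) [AddCommGroup N] [Module Sᵐᵒᵖ N]

/-- the biduality map `N → Hom_R(Hom_S(N,C),C)` for a right `S`-module `N`. -/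
def bidualityMapRight (n : N) : (N →ₗ[Sᵐᵒᵖ] C) →ₗ[R] C where
  toFun f := f n
  map_add' _ _ := rfl
  map_smul' _ _ := rfl

/-- a finitely generated right `S`-module `N` is `C`-reflexive. -/
structure IsCReflexiveRight : Prop where
  ext_vanish : ∀ i : ℕ, 0 < i → Subsingleton (ExtGrp Sᵐᵒᵖ i N C)
  ext_dual_vanish : ∀ i : ℕ, 0 < i → Subsingleton (ExtGrp R i (N →ₗ[Sᵐᵒᵖ] C) C)
  bij : Function.Bijective (bidualityMapRight R S C N)

end Bimodule

theorem extGrp_iff (A : Type) [Ring A] (i : ℕ) (hi : 0 < i) (M N : Type) [AddCommGroup M]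
    [Module A M] [AddCommGroup N] [Module A N] :
    Subsingleton (ExtGrp A i M N) ↔
      Subsingleton (Abelian.Ext (ModuleCat.of A M) (ModuleCat.of A N) i) := by
  obtain ⟨p, rfl⟩ : ∃ p, i = p + 1 := ⟨i - 1, by omega⟩
  let P := projectiveResolution (ModuleCat.of A M)
  let Y := ModuleCat.of A N
  have h1 : Subsingleton (ExtGrp A (p + 1) M N) ↔
      ((P.complex.linearYonedaObj ℤ Y).sc' p (p + 1) (p + 2)).Exact := by
    rw [← HomologicalComplex.exactAt_iff' (P.complex.linearYonedaObj ℤ Y) p (p + 1) (p + 2)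
      (by simp) (by simp),
      HomologicalComplex.exactAt_iff_isZero_homology]
    rw [← (P.isoExt (R := ℤ) (p + 1) Y).isZero_iff]
    exact (ModuleCat.isZero_iff_subsingleton (R := ℤ)).symm
  rw [h1, ShortComplex.moduleCat_exact_iff]
  constructor
  · intro h
    refine subsingleton_of_forall_eq 0 fun x => ?_
    obtain ⟨f, hf, rfl⟩ := P.extMk_surjective x (p + 2) rfl
    rw [P.extMk_eq_zero_iff f (p + 2) rfl hf p rfl]
    obtain ⟨g, hg⟩ := h f hf
    exact ⟨g, hg⟩
  · intro h x hx
    have := (P.extMk_eq_zero_iff x (p + 2) rfl hx p rfl).1 (Subsingleton.elim _ _)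
    obtain ⟨g, hg⟩ := this
    exact ⟨g, hg⟩

section Tools

variable {A : Type} [Ring A] {M₁ M₂ M₃ N : Type} [AddCommGroup M₁] [Module A M₁]
  [AddCommGroup M₂] [Module A M₂] [AddCommGroup M₃] [Module A M₃] [AddCommGroup N] [Module A N]
  (f : M₁ →ₗ[A] M₂) (g : M₂ →ₗ[A] M₃)

theorem ses_exists (hf : Function.Injective f) (hg : Function.Surjective g)
    (hfg : Function.Exact f g) :
    (ShortComplex.moduleCatMk f g hfg.linearMap_comp_eq_zero).ShortExact where
  exact := (ShortComplex.ShortExact.moduleCat_exact_iff_function_exact _).2 hfg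
  mono_f := (ModuleCat.mono_iff_injective _).2 hf
  epi_g := (ModuleCat.epi_iff_surjective _).2 hg

theorem ext_third (hf : Function.Injective f) (hg : Function.Surjective g)
    (hfg : Function.Exact f g) (i : ℕ) (hi : 0 < i) (h1 : Subsingleton (ExtGrp A i M₁ N))
    (h2 : Subsingleton (ExtGrp A (i + 1) M₂ N)) : Subsingleton (ExtGrp A (i + 1) M₃ N) := by
  rw [extGrp_iff _ _ (by omega)] at *
  refine subsingleton_of_forall_eq 0 fun x => ?_
  obtain ⟨y, hy⟩ := Abelian.Ext.contravariant_sequence_exact₃ (ses_exists f g hf hg hfg) _ x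
    (h2.elim _ _) (add_comm 1 i)
  rw [← hy, show y = 0 from h1.elim _ _, Abelian.Ext.comp_zero]
  rfl

theorem ext_third_one (hf : Function.Injective f) (hg : Function.Surjective g)
    (hfg : Function.Exact f g)
    (h1 : ∀ u : M₁ →ₗ[A] N, ∃ v : M₂ →ₗ[A] N, v ∘ₗ f = u)
    (h2 : Subsingleton (ExtGrp A 1 M₂ N)) : Subsingleton (ExtGrp A 1 M₃ N) := by
  rw [extGrp_iff _ _ (by omega)] at *
  refine subsingleton_of_forall_eq 0 fun x => ?_
  have hS := ses_exists f g hf hg hfg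
  obtain ⟨y, hy⟩ := Abelian.Ext.contravariant_sequence_exact₃ hS _ x
    (h2.elim _ _) (add_comm 1 0)
  obtain ⟨u, rfl⟩ := (Abelian.Ext.mk₀_bijective _ _).2 y
  obtain ⟨v, hv⟩ := h1 u.hom
  obtain ⟨w, hw⟩ : ∃ w : (ShortComplex.moduleCatMk f g hfg.linearMap_comp_eq_zero).X₂ ⟶
      ModuleCat.of A N, u = (ShortComplex.moduleCatMk f g hfg.linearMap_comp_eq_zero).f ≫ w :=
    ⟨ModuleCat.ofHom v, by ext1; exact hv.symm⟩
  rw [← hy, hw, ← Abelian.Ext.mk₀_comp_mk₀]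
  rw [← Abelian.Ext.comp_assoc_of_second_deg_zero, hS.extClass_comp, Abelian.Ext.zero_comp]
  rfl

theorem ext_first (hf : Function.Injective f) (hg : Function.Surjective g)
    (hfg : Function.Exact f g) (i : ℕ) (hi : 0 < i) (h2 : Subsingleton (ExtGrp A i M₂ N))
    (h3 : Subsingleton (ExtGrp A (i + 1) M₃ N)) : Subsingleton (ExtGrp A i M₁ N) := by
  rw [extGrp_iff _ _ (by omega)] at *
  refine subsingleton_of_forall_eq 0 fun x => ?_
  obtain ⟨y, hy⟩ := Abelian.Ext.contravariant_sequence_exact₁ (ses_exists f g hf hg hfg) _ x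
    (add_comm 1 i) (h3.elim _ _)
  rw [← hy, show y = 0 from h2.elim _ _, Abelian.Ext.comp_zero]
  rfl

theorem hom_extend (hf : Function.Injective f) (hg : Function.Surjective g)
    (hfg : Function.Exact f g)
    (h3 : Subsingleton (ExtGrp A 1 M₃ N)) (u : M₁ →ₗ[A] N) : ∃ v : M₂ →ₗ[A] N, v ∘ₗ f = u := by
  rw [extGrp_iff _ _ (by omega)] at *
  obtain ⟨y, hy⟩ := Abelian.Ext.contravariant_sequence_exact₁ (ses_exists f g hf hg hfg)
    (ModuleCat.of A N) (Abelian.Ext.mk₀ (ModuleCat.ofHom u)) (add_comm 1 0) (h3.elim _ _)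
  obtain ⟨v, rfl⟩ := (Abelian.Ext.mk₀_bijective _ _).2 y
  rw [Abelian.Ext.mk₀_comp_mk₀] at hy
  have := (Abelian.Ext.mk₀_bijective _ _).1 hy
  exact ⟨v.hom, congrArg ModuleCat.Hom.hom this⟩

theorem ext_proj (hP : Module.Projective A M₁) (i : ℕ) (hi : 0 < i) :
    Subsingleton (ExtGrp A i M₁ N) := by
  rw [extGrp_iff _ _ hi]
  obtain ⟨p, rfl⟩ : ∃ p, i = p + 1 := ⟨i - 1, by omega⟩
  have : Projective (ModuleCat.of A M₁) := (IsProjective.iff_projective _).1 hP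
  exact Abelian.Ext.subsingleton_of_projective _ _ _

theorem ext_pow (n : ℕ) (i : ℕ) (hi : 0 < i) (h : Subsingleton (ExtGrp A i M₁ N)) :
    Subsingleton (ExtGrp A i (Fin n → M₁) N) := by
  rw [extGrp_iff _ _ hi] at *
  refine subsingleton_of_forall_eq 0 fun x => ?_
  have hid : 𝟙 (ModuleCat.of A (Fin n → M₁)) = ∑ j : Fin n,
      ModuleCat.ofHom (LinearMap.proj (R := A) (φ := fun _ : Fin n => M₁) j) ≫
        ModuleCat.ofHom (LinearMap.single A (fun _ : Fin n => M₁) j) := by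
    apply ModuleCat.hom_ext
    rw [ModuleCat.hom_sum]
    apply LinearMap.ext
    intro c
    simp [LinearMap.sum_apply, Finset.univ_sum_single]
  rw [← Abelian.Ext.mk₀_id_comp x, hid, Abelian.Ext.mk₀_sum, Abelian.Ext.sum_comp]
  refine Finset.sum_eq_zero fun j _ => ?_
  rw [← Abelian.Ext.mk₀_comp_mk₀, Abelian.Ext.comp_assoc_of_second_deg_zero, h.elim
    ((Abelian.Ext.mk₀ _).comp x _) 0, Abelian.Ext.comp_zero]

end Tools

/-- every `C`-reflexive module `X` embeds in a finite direct sum of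
copies of `C` with `C`-reflexive cokernel: there is a short exact sequence
`0 → X → C⁰ → X¹ → 0` with `C⁰ ≅ C^{⊕n}` and `X¹` `C`-reflexive. -/
theorem embeds_into_addC
    (R S : Type) [Ring R] [IsNoetherianRing R] [Ring S] [IsNoetherianRing Sᵐᵒᵖ]
    (C : Type) [AddCommGroup C] [Module R C] [Module Sᵐᵒᵖ C]
    [SMulCommClass R Sᵐᵒᵖ C] [SMulCommClass Sᵐᵒᵖ R C]
    [Module.Finite R C] [Module.Finite Sᵐᵒᵖ C]
    (hC : IsSemidualizing R S C)
    (X : Type) [AddCommGroup X] [Module R X] [Module.Finite R X]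
    (hX : IsCReflexive R S C X) :
    ∃ (n : ℕ) (X₁ : Type) (_ : AddCommGroup X₁) (_ : Module R X₁),
      Module.Finite R X₁ ∧ IsCReflexive R S C X₁ ∧
      ∃ (ι : X →ₗ[R] (Fin n → C)) (π : (Fin n → C) →ₗ[R] X₁),
        Function.Injective ι ∧ Function.Surjective π ∧ Function.Exact ι π := by
  classical
  -- the dual of `X` is finitely generated
  have hfin : Module.Finite Sᵐᵒᵖ (X →ₗ[R] C) := by
    obtain ⟨m, x, hx⟩ := Module.Finite.exists_fin (R := R) (M := X)
    let ev : (X →ₗ[R] C) →ₗ[Sᵐᵒᵖ] (Fin m → C) :=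
      { toFun := fun f j => f (x j)
        map_add' := fun _ _ => rfl
        map_smul' := fun _ _ => rfl }
    refine Module.Finite.of_injective ev fun f g hfg => ?_
    exact LinearMap.ext_on_range hx fun j => congrFun hfg j
  obtain ⟨n, e, he⟩ := Module.Finite.exists_fin (R := Sᵐᵒᵖ) (M := X →ₗ[R] C)
  let ι : X →ₗ[R] (Fin n → C) := LinearMap.pi e
  let X₁ := (Fin n → C) ⧸ LinearMap.range ι
  let π : (Fin n → C) →ₗ[R] X₁ := (LinearMap.range ι).mkQ
  have hπ : Function.Surjective π := Submodule.mkQ_surjective _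
  have hex : Function.Exact ι π := by
    rw [LinearMap.exact_iff]
    exact Submodule.ker_mkQ _
  let pr : Fin n → ((Fin n → C) →ₗ[R] C) := fun j => LinearMap.proj j
  -- the dual of `ι` is surjective
  have hlift : ∀ u : X →ₗ[R] C, ∃ v : (Fin n → C) →ₗ[R] C, v ∘ₗ ι = u := by
    intro u
    have hu : u ∈ Submodule.span Sᵐᵒᵖ (Set.range e) := he ▸ Submodule.mem_top
    obtain ⟨s, rfl⟩ := (Submodule.mem_span_range_iff_exists_fun _).1 hu
    refine ⟨∑ j, s j • pr j, ?_⟩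
    ext x
    simp [pr, ι, LinearMap.sum_apply]
  have hι : Function.Injective ι := by
    intro x y hxy
    apply hX.bij.1
    ext u
    obtain ⟨v, rfl⟩ := hlift u
    change v (ι x) = v (ι y)
    rw [hxy]
  -- functionals on `C^n`
  have hform : ∀ v : (Fin n → C) →ₗ[R] C, ∃ s : Fin n → Sᵐᵒᵖ, v = ∑ j, s j • pr j := by
    intro v
    have : ∀ j, ∃ s : S, rightHomothety R S C s = v ∘ₗ LinearMap.single R (fun _ => C) j :=
      fun j => hC.bij_right.2 _
    choose s hs using this
    refine ⟨fun j => MulOpposite.op (s j), ?_⟩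
    apply LinearMap.pi_ext'
    intro j
    rw [← hs]
    ext c
    simp only [LinearMap.comp_apply, LinearMap.sum_apply, LinearMap.smul_apply, pr,
      LinearMap.proj_apply, LinearMap.single_apply]
    rw [Finset.sum_eq_single j]
    · simp [rightHomothety]
    · intro b _ hb
      simp [hb]
    · simp
  have hproj : Module.Projective Sᵐᵒᵖ ((Fin n → C) →ₗ[R] C) := by
    let hom : Sᵐᵒᵖ →ₗ[Sᵐᵒᵖ] (C →ₗ[R] C) :=
      { toFun := fun s => rightHomothety R S C s.unop
        map_add' := fun a b => by ext c; exact add_smul a b c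
        map_smul' := fun a b => by ext c; exact mul_smul a b c }
    have hb : Function.Bijective hom :=
      hC.bij_right.comp MulOpposite.unop_bijective
    have h2 : Module.Projective Sᵐᵒᵖ (Fin n → (C →ₗ[R] C)) :=
      Module.Projective.of_equiv (M := Fin n → Sᵐᵒᵖ)
        (LinearEquiv.piCongrRight fun _ => LinearEquiv.ofBijective hom hb)
    exact Module.Projective.of_equiv (LinearMap.lsum R (fun _ : Fin n => C) Sᵐᵒᵖ)
  -- the dual short exact sequence
  let πd : (X₁ →ₗ[R] C) →ₗ[Sᵐᵒᵖ] ((Fin n → C) →ₗ[R] C) :=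
    { toFun := fun h => h ∘ₗ π
      map_add' := fun _ _ => rfl
      map_smul' := fun _ _ => rfl }
  let ιd : ((Fin n → C) →ₗ[R] C) →ₗ[Sᵐᵒᵖ] (X →ₗ[R] C) :=
    { toFun := fun h => h ∘ₗ ι
      map_add' := fun _ _ => rfl
      map_smul' := fun _ _ => rfl }
  have hπd : Function.Injective πd := by
    intro a b hab
    exact (LinearMap.cancel_right hπ).1 hab
  have hιd : Function.Surjective ιd := hlift
  have hexd : Function.Exact πd ιd := by
    intro v
    constructor
    · intro hv
      refine ⟨(LinearMap.range ι).liftQ v ?_, ?_⟩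
      · rintro _ ⟨x, rfl⟩
        exact LinearMap.congr_fun hv x
      · exact Submodule.liftQ_mkQ _ _ _
    · rintro ⟨h, rfl⟩
      change (h ∘ₗ π) ∘ₗ ι = 0
      rw [LinearMap.comp_assoc, hex.linearMap_comp_eq_zero, LinearMap.comp_zero]
  -- `C^n` is reflexive
  have hCn_inj : ∀ c d : Fin n → C, (∀ v : (Fin n → C) →ₗ[R] C, v c = v d) → c = d :=
    fun c d h => funext fun j => h (pr j)
  have hCn_surj : ∀ F : ((Fin n → C) →ₗ[R] C) →ₗ[Sᵐᵒᵖ] C, ∃ c : Fin n → C, ∀ v, F v = v c := by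
    intro F
    refine ⟨fun j => F (pr j), fun v => ?_⟩
    obtain ⟨s, rfl⟩ := hform v
    simp [LinearMap.sum_apply, pr]
  refine ⟨n, X₁, inferInstance, inferInstance, Module.Finite.of_surjective π hπ,
    ⟨?_, ?_, ?_, ?_⟩, ι, π, hι, hπ, hex⟩
  · intro i hi
    have hCn := ext_pow n i hi (hC.ext_right i hi)
    obtain ⟨p, rfl⟩ : ∃ p, i = p + 1 := ⟨i - 1, by omega⟩
    rcases Nat.eq_zero_or_pos p with rfl | hp
    · exact ext_third_one ι π hι hπ hex hlift hCn
    · exact ext_third ι π hι hπ hex p hp (hX.ext_vanish p hp) hCn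
  · intro i hi
    exact ext_first πd ιd hπd hιd hexd i hi (ext_proj hproj i hi)
      (hX.ext_dual_vanish (i + 1) (by omega))
  · intro a b hab
    obtain ⟨c, rfl⟩ := hπ a
    obtain ⟨d, rfl⟩ := hπ b
    have hcd : ∀ h : X₁ →ₗ[R] C, h (π (c - d)) = 0 := by
      intro h
      have : h (π c) = h (π d) := LinearMap.congr_fun hab h
      rw [map_sub, map_sub, this, sub_self]
    let F : ((Fin n → C) →ₗ[R] C) →ₗ[Sᵐᵒᵖ] C := bidualityMap R S C (Fin n → C) (c - d)
    have hker : ∀ v, ιd v = 0 → F v = 0 := by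
      intro v hv
      obtain ⟨h, rfl⟩ := (hexd v).1 hv
      exact hcd h
    choose sec hsec using hιd
    have hF : ∀ v w, ιd v = ιd w → F v = F w := by
      intro v w hvw
      rw [← sub_eq_zero, ← map_sub]
      exact hker _ (by rw [map_sub, hvw, sub_self])
    let G : (X →ₗ[R] C) →ₗ[Sᵐᵒᵖ] C :=
      { toFun := fun u => F (sec u)
        map_add' := fun u w => by
          rw [← map_add]
          exact hF _ _ (by rw [map_add, hsec, hsec, hsec])
        map_smul' := fun s u => by
          rw [RingHom.id_apply, ← map_smul]
          exact hF _ _ (by rw [map_smul, hsec, hsec]) }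
    obtain ⟨x, hx⟩ := hX.bij.2 G
    have hcx : c - d = ι x := by
      apply hCn_inj
      intro v
      have h1 : F v = F (sec (ιd v)) := hF _ _ (hsec _).symm
      have h2 : v (ι x) = F (sec (ιd v)) := LinearMap.congr_fun hx (ιd v)
      rw [h2, ← h1]
      rfl
    rw [← sub_eq_zero, ← map_sub, hcx]
    exact hex.apply_apply_eq_zero x
  · intro H
    obtain ⟨F, hF⟩ := hom_extend πd ιd hπd hιd hexd (hX.ext_dual_vanish 1 one_pos) H
    obtain ⟨c, hc⟩ := hCn_surj F
    refine ⟨π c, ?_⟩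
    ext h
    rw [← hF]
    exact (hc (πd h)).symm
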